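/- Let n = 2^k for some natural number k ≥ 1. Then 2n − 1 is the minimal dimension N for which there exists an N-dimensional subspace F of C(ℝ,ℝ) such that every non-resonant n-chord diagram defines a subspace of codimension exactly n in F. Precisely: (i) the (2n−1)-dimensional space P^{2n−1} has the property that for every non-resonant n-chord diagram (a_i, b_i) the subspace {p ∈ P^{2n−1} : p(a_i) = p(b_i) for all i} has dimension exactly (2n−1) − n; and (ii) for every subspace F of C(ℝ,ℝ) of dimension N < 2n − 1 there exists a non-resonant n-chord diagram (a_i, b_i) such that {f ∈ F : f(a_i) = f(b_i) for all i} has dimension strictly greater than N − n. -/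

import Mathlib

/-- The linear functional `f ↦ f b - f a` on the space `C(ℝ, ℝ)` of continuous
functions `ℝ → ℝ`. -/
noncomputable def evalDiff (a b : ℝ) : C(ℝ, ℝ) →ₗ[ℝ] ℝ where
  toFun f := f b - f a
  map_add' f g := by simp; ring
  map_smul' c f := by simp [mul_sub]

/-- `P^N`: the `N`-dimensional space of real polynomials of degree at most `N`
with zero constant term. -/
noncomputable def Pspace (N : ℕ) : Submodule ℝ (Polynomial ℝ) :=
  Polynomial.degreeLE ℝ (N : ℕ) ⊓ LinearMap.ker (Polynomial.lcoeff ℝ 0)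

/-- The symmetrized product of a `0`-cochain `u` with a cochain `c` (mod 2): sum over all entries
of the list of `u` at that entry times `c` at the list with the entry removed. -/
def wedge {X : Type*} (u : X → ZMod 2) : (List X → ZMod 2) → List X → ZMod 2
  | _, [] => 0
  | c, x :: l => u x * c l + wedge u (fun t => c (x :: t)) l

/-- The prism operator attached to a pair of maps. -/
def prism {X : Type*} (f g : X → X) : (List X → ZMod 2) → List X → ZMod 2
  | _, [] => 0
  | c, x :: l => c (f x :: g x :: l.map g) + prism f g (fun t => c (f x :: t)) l

section Wedge

variable {X : Type*}

lemma wedge_add_right (u : X → ZMod 2) (c c' : List X → ZMod 2) (l : List X) :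
    wedge u (fun t => c t + c' t) l = wedge u c l + wedge u c' l := by
  induction l generalizing c c' with
  | nil => simp [wedge]
  | cons x l ih => simp only [wedge, ih]; ring

lemma wedge_mul_right (u : X → ZMod 2) (r : ZMod 2) (c : List X → ZMod 2) (l : List X) :
    wedge u (fun t => r * c t) l = r * wedge u c l := by
  induction l generalizing c with
  | nil => simp [wedge]
  | cons x l ih => simp only [wedge, ih]; ring

lemma wedge_zero_right (u : X → ZMod 2) (l : List X) : wedge u (fun _ => 0) l = 0 := by
  induction l with
  | nil => simp [wedge]
  | cons x l ih => simp [wedge, ih]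

lemma wedge_add_left (u w : X → ZMod 2) (c : List X → ZMod 2) (l : List X) :
    wedge (fun x => u x + w x) c l = wedge u c l + wedge w c l := by
  induction l generalizing c with
  | nil => simp [wedge]
  | cons x l ih => simp only [wedge, ih]; ring

lemma wedge_congr_left {u w : X → ZMod 2} {l : List X} (h : ∀ x ∈ l, u x = w x)
    (c : List X → ZMod 2) : wedge u c l = wedge w c l := by
  induction l generalizing c with
  | nil => simp [wedge]
  | cons x l ih =>
    simp only [wedge, h x (by simp)]
    rw [ih (fun y hy => h y (by simp [hy]))]

lemma wedge_eq_zero {u : X → ZMod 2} {l : List X} (h : ∀ x ∈ l, u x = 0)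
    (c : List X → ZMod 2) : wedge u c l = 0 := by
  induction l generalizing c with
  | nil => simp [wedge]
  | cons x l ih =>
    simp only [wedge, h x (by simp)]
    rw [ih (fun y hy => h y (by simp [hy]))]; simp

lemma wedge_congr_right {u : X → ZMod 2} {c c' : List X → ZMod 2} {l : List X}
    (h : ∀ t, t.Sublist l → c t = c' t) : wedge u c l = wedge u c' l := by
  induction l generalizing c c' with
  | nil => simp [wedge]
  | cons x l ih =>
    simp only [wedge, h l (by simp)]
    rw [ih (fun t ht => h _ (ht.cons_cons x))]

lemma wedge_map {Y : Type*} (f : X → Y) (u : Y → ZMod 2) (c : List Y → ZMod 2) (l : List X) :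
    wedge u c (l.map f) = wedge (fun x => u (f x)) (fun t => c (t.map f)) l := by
  induction l generalizing c with
  | nil => simp [wedge]
  | cons x l ih => simp [wedge, ih]

lemma wedge_comm (u w : X → ZMod 2) (c : List X → ZMod 2) (l : List X) :
    wedge u (wedge w c) l = wedge w (wedge u c) l := by
  induction l generalizing c with
  | nil => simp [wedge]
  | cons x l ih =>
    simp only [wedge, wedge_add_right, wedge_mul_right, ih]; ring

lemma wedge_wedge_self (u : X → ZMod 2) (c : List X → ZMod 2) (l : List X) :
    wedge u (wedge u c) l = 0 := by
  induction l generalizing c with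
  | nil => simp [wedge]
  | cons x l ih =>
    simp only [wedge, wedge_add_right, wedge_mul_right, ih, add_zero]
    exact CharTwo.add_self_eq_zero _

lemma wedge_wedge_eq_zero {u w : X → ZMod 2} {l : List X}
    (h : ∀ x ∈ l, ∀ y ∈ l, u x * w y = 0) (c : List X → ZMod 2) :
    wedge u (wedge w c) l = 0 := by
  induction l generalizing c with
  | nil => simp [wedge]
  | cons x l ih =>
    simp only [wedge, wedge_add_right, wedge_mul_right]
    have h1 : u x * wedge w c l = 0 := by
      by_cases hu : u x = 0
      · simp [hu]
      · rw [wedge_eq_zero, mul_zero]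
        exact fun y hy => (mul_eq_zero.1 (h x (by simp) y (by simp [hy]))).resolve_left hu
    have h2 : w x * wedge u c l = 0 := by
      by_cases hw : w x = 0
      · simp [hw]
      · rw [wedge_eq_zero, mul_zero]
        exact fun y hy => (mul_eq_zero.1 (h y (by simp [hy]) x (by simp))).resolve_right hw
    rw [h1, h2, ih (fun y hy z hz => h y (by simp [hy]) z (by simp [hz]))]
    simp

lemma prism_add (f g : X → X) (c c' : List X → ZMod 2) (l : List X) :
    prism f g (fun t => c t + c' t) l = prism f g c l + prism f g c' l := by
  induction l generalizing c c' with
  | nil => simp [prism]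
  | cons x l ih => simp only [prism, ih]; ring

/-- The prism operator is a chain homotopy; the coboundary is `wedge 1`. -/
lemma prism_coboundary (f g : X → X) (c : List X → ZMod 2) (l : List X) :
    prism f g (wedge (fun _ => 1) c) l + wedge (fun _ => 1) (prism f g c) l
      = c (l.map g) + c (l.map f) := by
  induction l generalizing c with
  | nil => simp [prism, wedge, CharTwo.add_self_eq_zero]
  | cons x l ih =>
    have h2 : (2 : ZMod 2) = 0 := rfl
    have := ih (fun t => c (f x :: t))
    have h3 := wedge_map g (fun _ => 1) (fun t => c (f x :: g x :: t)) l
    simp only [prism, wedge, wedge_add_right, prism_add, List.map_cons, one_mul] at this h3 ⊢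
    linear_combination this + h3 + (prism f g c l + c (f x :: l.map g)
      + wedge (fun _ => 1) (fun t => c (f x :: g x :: t.map g)) l) * h2

lemma prism_congr {f g : X → X} {c c' : List X → ZMod 2} {l : List X}
    (h : ∀ t : List X, (∀ y ∈ t, ∃ x ∈ l, y = f x ∨ y = g x) → c t = c' t) :
    prism f g c l = prism f g c' l := by
  induction l generalizing c c' with
  | nil => simp [prism]
  | cons x l ih =>
    simp only [prism]
    congr 1
    · apply h
      intro y hy
      simp only [List.mem_cons, List.mem_map] at hy ⊢
      grind
    · apply ih
      intro t ht
      apply h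
      intro y hy
      simp only [List.mem_cons] at hy ⊢
      grind

/-- `alternating u j q s`: indicator (mod 2) of the lists of length `q` whose labels, among the
first `j` absolute values, alternate in sign when sorted, the largest one having sign `s`.
The `0`-cochain `u i s` is the indicator of the label `s i`. -/
def alternating (u : ℕ → Bool → X → ZMod 2) : ℕ → ℕ → Bool → List X → ZMod 2
  | _, 0, _ => fun l => if l = [] then 1 else 0
  | 0, _ + 1, _ => fun _ => 0
  | j + 1, q + 1, s => fun l =>
      alternating u j (q + 1) s l + wedge (u j s) (alternating u j q (!s)) l

lemma alternating_eq_zero (u : ℕ → Bool → X → ZMod 2) {j q : ℕ} (h : j < q) (s : Bool)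
    (l : List X) : alternating u j q s l = 0 := by
  induction j generalizing q s l with
  | zero =>
    obtain ⟨q, rfl⟩ : ∃ p, q = p + 1 := ⟨q - 1, by omega⟩
    simp [alternating]
  | succ j ih =>
    obtain ⟨q, rfl⟩ : ∃ p, q = p + 1 := ⟨q - 1, by omega⟩
    have : alternating u j q (!s) = fun _ => 0 := funext fun l => ih (by omega) _ l
    simp [alternating, ih (show j < q + 1 by omega), this, wedge_zero_right]

lemma alternating_map {u : ℕ → Bool → X → ZMod 2} {f : X → X}
    (hu : ∀ j s x, u j s (f x) = u j (!s) x) (j q : ℕ) (s : Bool) (l : List X) :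
    alternating u j q s (l.map f) = alternating u j q (!s) l := by
  induction j generalizing q s l with
  | zero => cases q <;> simp [alternating]
  | succ j ih =>
    cases q with
    | zero => simp [alternating]
    | succ q => simp [alternating, ih, wedge_map, hu]

/-- The indicator of a label of absolute value less than `j`. -/
def labelled (u : ℕ → Bool → X → ZMod 2) : ℕ → X → ZMod 2
  | 0 => fun _ => 0
  | j + 1 => fun x => labelled u j x + (u j true x + u j false x)

lemma wedge_labelled_alternating {u : ℕ → Bool → X → ZMod 2} (j q : ℕ) (s : Bool) {l : List X}
    (hl : ∀ j s, ∀ x ∈ l, ∀ y ∈ l, u j s x * u j (!s) y = 0) :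
    wedge (labelled u j) (alternating u j q s) l
      = alternating u j (q + 1) s l + alternating u j (q + 1) (!s) l := by
  induction j generalizing q s l with
  | zero => simp [labelled, alternating, wedge_eq_zero]
  | succ j ih =>
    have h2 : (2 : ZMod 2) = 0 := rfl
    have hU : ∀ c, wedge (labelled u (j + 1)) c l
        = wedge (labelled u j) c l + (wedge (u j s) c l + wedge (u j (!s)) c l) := by
      intro c
      cases s <;> simp only [labelled, wedge_add_left, Bool.not_true, Bool.not_false]; all_goals ring
    rw [hU]
    cases q with
    | zero =>
      have := ih 0 s hl
      have h0 : ∀ s s', alternating u j 0 s = alternating u (j+1) 0 s' := by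
        intro s s'; funext l; simp [alternating]
      rw [h0 s s] at this
      rw [this]
      have e : ∀ s', alternating u (j + 1) (0 + 1) s' l = alternating u j (0 + 1) s' l
          + wedge (u j s') (alternating u j 0 (!s')) l := fun _ => rfl
      rw [e, e, h0 (!s) s, h0 (!!s) s]
      ring
    | succ q =>
      have h1 := ih (q + 1) s hl
      have h3 : wedge (u j s) (wedge (labelled u j) (alternating u j q (!s))) l
          = wedge (u j s) (fun t => alternating u j (q + 1) (!s) t
            + alternating u j (q + 1) s t) l := by
        apply wedge_congr_right
        intro t ht
        rw [ih q (!s) (fun j s x hx y hy => hl j s x (ht.subset hx) y (ht.subset hy))]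
        simp
      have h4 := wedge_wedge_self (u j s) (alternating u j q (!s)) l
      have h5 := wedge_wedge_eq_zero (u := u j (!s)) (w := u j s) (l := l)
        (fun x hx y hy => by rw [mul_comm]; exact hl j s y hy x hx) (alternating u j q (!s))
      rw [wedge_comm] at h3
      simp only [alternating, wedge_add_right, Bool.not_not] at h1 h3 h4 h5 ⊢
      linear_combination h1 + h3 + h4 + h5 + (wedge (u j s) (alternating u j (q+1) s) l) * h2

end Wedge

section Sweep

variable {m : ℕ}

/-- The sign vector `h` replaced by `true` before position `τ`. -/
def sweep (τ : ℕ) (h : Fin m → Bool) : Fin m → Bool := fun x => if x.val < τ then true else h x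

/-- The antipodal sign vector. -/
def antipode (h : Fin m → Bool) : Fin m → Bool := fun x => !h x

/-- The chain homotopy given by sweeping all sign vectors to the constant one. -/
def sweepOp (c : List (Fin m → Bool) → ZMod 2) (l : List (Fin m → Bool)) : ZMod 2 :=
  ∑ τ ∈ Finset.range m, prism (sweep τ) (sweep (τ + 1)) c l

/-- Evaluation of a cochain on the `k`-dimensional hemisphere, built inductively as the
cone, by `sweepOp`, over the `(k-1)`-dimensional sphere. -/
def hemisphere : ℕ → (List (Fin m → Bool) → ZMod 2) → ZMod 2
  | 0, c => c [fun _ => true]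
  | k + 1, c => hemisphere k (fun l => sweepOp c l + sweepOp c (l.map antipode))

lemma antipode_antipode (h : Fin m → Bool) : antipode (antipode h) = h := by
  funext x; simp [antipode]

lemma sweep_zero (h : Fin m → Bool) : sweep 0 h = h := by
  funext x; simp [sweep]

lemma sweep_self (h : Fin m → Bool) : sweep m h = fun _ => true := by
  funext x; simp [sweep]

lemma sweepOp_add (c c' : List (Fin m → Bool) → ZMod 2) (l : List (Fin m → Bool)) :
    sweepOp (fun t => c t + c' t) l = sweepOp c l + sweepOp c' l := by
  simp [sweepOp, prism_add, Finset.sum_add_distrib]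

lemma wedge_sum_right {X ι : Type*} (s : Finset ι) (u : X → ZMod 2)
    (c : ι → List X → ZMod 2) (l : List X) :
    wedge u (fun t => ∑ i ∈ s, c i t) l = ∑ i ∈ s, wedge u (c i) l := by
  classical
  induction s using Finset.induction_on with
  | empty => simp [wedge_zero_right]
  | insert i s hi ih => simp [Finset.sum_insert hi, wedge_add_right, ih]

lemma sweepOp_coboundary (c : List (Fin m → Bool) → ZMod 2) (l : List (Fin m → Bool)) :
    sweepOp (wedge (fun _ => 1) c) l + wedge (fun _ => 1) (sweepOp c) l
      = c (l.map fun _ _ => true) + c l := by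
  have : wedge (fun _ => 1) (sweepOp c) l
      = ∑ τ ∈ Finset.range m, wedge (fun _ => 1) (prism (sweep τ) (sweep (τ + 1)) c) l :=
    wedge_sum_right _ _ _ _
  rw [this, sweepOp, ← Finset.sum_add_distrib]
  simp only [prism_coboundary]
  have h := Finset.sum_range_sub (fun τ => c (l.map (sweep τ))) m
  simp only [CharTwo.sub_eq_add] at h
  rw [h]
  have h0 : l.map (sweep 0) = l := by simp [funext sweep_zero]
  have h1 : l.map (sweep m) = l.map fun _ _ => true := by simp [funext sweep_self]
  rw [h0, h1]

lemma hemisphere_add (k : ℕ) (c c' : List (Fin m → Bool) → ZMod 2) :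
    hemisphere k (fun t => c t + c' t) = hemisphere k c + hemisphere k c' := by
  induction k generalizing c c' with
  | zero => simp [hemisphere]
  | succ k ih =>
    simp only [hemisphere, sweepOp_add, ← ih]
    congr 1; funext l; ring

lemma hemisphere_coboundary (k : ℕ) (c : List (Fin m → Bool) → ZMod 2) :
    hemisphere (k + 1) (wedge (fun _ => 1) c)
      = hemisphere k (fun l => c l + c (l.map antipode)) := by
  induction k generalizing c with
  | zero =>
    have h2 : (2 : ZMod 2) = 0 := rfl
    have h1 := sweepOp_coboundary c [fun _ => true]
    have h3 := sweepOp_coboundary c [antipode fun _ => true]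
    simp only [wedge, hemisphere, List.map_cons, List.map_nil] at h1 h3 ⊢
    linear_combination h1 + h3 - (sweepOp c [] - c [fun _ => true]) * h2
  | succ k ih =>
    have h2 : (2 : ZMod 2) = 0 := rfl
    have key : (fun l => sweepOp (wedge (fun _ => 1) c) l
          + sweepOp (wedge (fun _ => 1) c) (l.map antipode))
        = fun l => (c l + c (l.map antipode)) +
          wedge (fun _ => 1) (fun t => sweepOp c t + sweepOp c (t.map antipode)) l := by
      funext l
      have h1 := sweepOp_coboundary c l
      have h3 := sweepOp_coboundary c (l.map antipode)
      rw [wedge_map] at h3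
      simp only [List.map_map, Function.comp_def, wedge_add_right] at h1 h3 ⊢
      linear_combination h1 + h3 + (c (l.map fun _ _ => true) -
        wedge (fun _ => 1) (sweepOp c) l -
        wedge (fun _ => 1) (fun t => sweepOp c (t.map antipode)) l) * h2
    rw [hemisphere, key, hemisphere_add, ih]
    have : (fun l : List (Fin m → Bool) => sweepOp c l + sweepOp c (l.map antipode)
        + (sweepOp c (l.map antipode) + sweepOp c ((l.map antipode).map antipode)))
        = fun l => 0 + 0 := by
      funext l
      have : (l.map antipode).map antipode = l := by
        simp [Function.comp_def, antipode_antipode]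
      rw [this]
      linear_combination (sweepOp c l + sweepOp c (l.map antipode)) * h2
    rw [this, hemisphere_add k (fun _ => 0) (fun _ => 0), CharTwo.add_self_eq_zero, add_zero]

/-- The sign vectors with at most `k` sign changes, given by the sorted list of their cuts,
the first sign being positive. -/
def cutVectors (m k : ℕ) : Set (Fin m → Bool) :=
  {h | ∃ t : List ℕ, t.Pairwise (· ≤ ·) ∧ (∀ y ∈ t, y ≤ m) ∧ t.length ≤ k ∧
    ∀ x, h x = decide (Even (t.countP (· ≤ x.val)))}

lemma cutVectors_mono {k k' : ℕ} (h : k ≤ k') : cutVectors m k ⊆ cutVectors m k' := by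
  rintro f ⟨t, h1, h2, h3, h4⟩
  exact ⟨t, h1, h2, h3.trans h, h4⟩

lemma true_mem_cutVectors : (fun _ => true) ∈ cutVectors m 0 :=
  ⟨[], by simp⟩

lemma antipode_mem_cutVectors {k : ℕ} {h : Fin m → Bool} (hh : h ∈ cutVectors m k) :
    antipode h ∈ cutVectors m (k + 1) := by
  obtain ⟨t, h1, h2, h3, h4⟩ := hh
  refine ⟨0 :: t, by simp [h1], by simpa using h2, by simpa using h3, fun x => ?_⟩
  simp only [antipode, h4]
  simp [Nat.even_add_one, -Nat.not_even_iff_odd]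

lemma sweep_mem_cutVectors {k τ : ℕ} (hτ : τ ≤ m) {h : Fin m → Bool}
    (hh : h ∈ cutVectors m k) : sweep τ h ∈ cutVectors m k := by
  obtain ⟨t, h1, h2, h3, h4⟩ := hh
  refine ⟨t.map (max τ), h1.map _ fun a b hab => by omega, ?_, by simpa using h3,
    fun x => ?_⟩
  · simp only [List.mem_map]
    rintro y ⟨z, hz, rfl⟩
    exact max_le hτ (h2 z hz)
  · simp only [sweep, h4, List.countP_map, Function.comp_def, sup_le_iff]
    split_ifs with hx
    · have : ¬ τ ≤ x.val := by omega
      simp [this]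
    · have : τ ≤ x.val := by omega
      simp [this]

lemma hammingDist_sweep_le (τ : ℕ) (h h' : Fin m → Bool) :
    hammingDist (sweep τ h) (sweep τ h') ≤ hammingDist h h' := by
  unfold hammingDist
  apply Finset.card_le_card
  intro x hx
  rw [Finset.mem_filter_univ] at hx ⊢
  simp only [sweep] at hx
  grind

lemma hammingDist_sweep_succ_le (τ : ℕ) (h : Fin m → Bool) :
    hammingDist (sweep τ h) (sweep (τ + 1) h) ≤ 1 := by
  unfold hammingDist
  apply Finset.card_le_one.2
  intro a ha b hb
  rw [Finset.mem_filter_univ] at ha hb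
  simp only [sweep] at ha hb
  apply Fin.ext
  grind

lemma hammingDist_antipode (h h' : Fin m → Bool) :
    hammingDist (antipode h) (antipode h') = hammingDist h h' := by
  simp [hammingDist, antipode]

/-- The lists of sign vectors with at most `k` sign changes and at mutual Hamming distance at
most `k`. -/
def SmallList (m k : ℕ) (l : List (Fin m → Bool)) : Prop :=
  (∀ h ∈ l, h ∈ cutVectors m k) ∧ ∀ h ∈ l, ∀ h' ∈ l, hammingDist h h' ≤ k

lemma sweepOp_congr {k : ℕ} {c c' : List (Fin m → Bool) → ZMod 2} {l : List (Fin m → Bool)}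
    (hl : ∀ h ∈ l, h ∈ cutVectors m (k + 1)) (hl' : ∀ h ∈ l, ∀ h' ∈ l, hammingDist h h' ≤ k)
    (hc : ∀ t, SmallList m (k + 1) t → c t = c' t) : sweepOp c l = sweepOp c' l := by
  refine Finset.sum_congr rfl fun τ hτ => prism_congr fun t ht => hc t ⟨?_, ?_⟩
  · intro y hy
    obtain ⟨x, hx, rfl | rfl⟩ := ht y hy
    · exact sweep_mem_cutVectors (by simp at hτ; omega) (hl x hx)
    · exact sweep_mem_cutVectors (by simp at hτ; omega) (hl x hx)
  · intro y hy z hz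
    obtain ⟨x, hx, hyx⟩ := ht y hy
    obtain ⟨w, hw, hzw⟩ := ht z hz
    have h0 := hl' x hx w hw
    have h1 := hammingDist_sweep_le τ x w
    have h2 := hammingDist_sweep_le (τ + 1) x w
    have h3 := hammingDist_sweep_succ_le τ x
    have h4 := hammingDist_sweep_succ_le τ w
    rcases hyx with rfl | rfl <;> rcases hzw with rfl | rfl
    · omega
    · have := hammingDist_triangle (sweep τ x) (sweep τ w) (sweep (τ + 1) w)
      omega
    · have := hammingDist_triangle (sweep (τ + 1) x) (sweep τ x) (sweep τ w)
      rw [hammingDist_comm (sweep (τ + 1) x) (sweep τ x)] at this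
      omega
    · omega

lemma hemisphere_congr {k : ℕ} {c c' : List (Fin m → Bool) → ZMod 2}
    (hc : ∀ l, SmallList m k l → c l = c' l) : hemisphere k c = hemisphere k c' := by
  induction k generalizing c c' with
  | zero => exact hc _ ⟨by simpa using true_mem_cutVectors, by simp⟩
  | succ k ih =>
    refine ih fun l hl => ?_
    congr 1
    · exact sweepOp_congr (fun h hh => cutVectors_mono k.le_succ (hl.1 h hh)) hl.2 hc
    · refine sweepOp_congr ?_ ?_ hc
      · simp only [List.mem_map]
        rintro _ ⟨h, hh, rfl⟩
        exact antipode_mem_cutVectors (hl.1 h hh)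
      · simp only [List.mem_map]
        rintro _ ⟨h, hh, rfl⟩ _ ⟨h', hh', rfl⟩
        rw [hammingDist_antipode]
        exact hl.2 h hh h' hh'

/-- A Tucker-type lemma for sign vectors with at most `N` sign changes. -/
lemma exists_label_ne_one {N : ℕ} {u : ℕ → Bool → (Fin m → Bool) → ZMod 2}
    (hu : ∀ j s h, u j s (antipode h) = u j (!s) h)
    (hcompl : ∀ j s h h', hammingDist h h' ≤ N → u j s h * u j (!s) h' = 0) :
    ∃ h ∈ cutVectors m N, labelled u N h ≠ 1 := by
  by_contra! hall
  have key : ∀ k ≤ N, hemisphere k (fun l => alternating u N (k + 1) true l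
      + alternating u N (k + 1) false l) = 1 := by
    intro k hk
    induction k with
    | zero =>
      have h1 := wedge_labelled_alternating (u := u) N 0 true (l := [fun _ => true]) (by
        intro j s x hx y hy
        simp only [List.mem_singleton] at hx hy
        subst hx hy
        exact hcompl _ _ _ _ (by simp))
      have h2 := hall _ (cutVectors_mono N.zero_le true_mem_cutVectors)
      simp only [hemisphere]
      simp only [Bool.not_true] at h1
      rw [← h1]
      simp [wedge, h2, alternating]
    | succ k ih =>
      rw [← ih (by omega)]
      have h1 := hemisphere_coboundary (m := m) k (alternating u N (k + 1) true)
      simp only [alternating_map hu, Bool.not_true] at h1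
      rw [← h1]
      refine hemisphere_congr fun l hl => ?_
      have h2 := wedge_labelled_alternating (u := u) N (k + 1) true (l := l)
        fun j s x hx y hy => hcompl _ _ _ _ ((hl.2 x hx y hy).trans hk)
      simp only [Bool.not_true] at h2
      rw [← h2]
      exact wedge_congr_left (fun x hx => hall x (cutVectors_mono hk (hl.1 x hx))) _
  have h := key N le_rfl
  simp only [alternating_eq_zero u N.lt_succ_self] at h
  rw [hemisphere_add, CharTwo.add_self_eq_zero] at h
  exact zero_ne_one h

end Sweep

section HobbyRice

/-- The integral of the sign vector `h` against the weights `d`. -/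
def signedSum {m : ℕ} (d : Fin m → ℝ) (h : Fin m → Bool) : ℝ :=
  ∑ x, if h x then d x else -d x

lemma signedSum_antipode {m : ℕ} (d : Fin m → ℝ) (h : Fin m → Bool) :
    signedSum d (antipode h) = -signedSum d h := by
  simp only [signedSum, antipode, ← Finset.sum_neg_distrib]
  refine Finset.sum_congr rfl fun x _ => ?_
  by_cases hx : h x = true <;> simp [hx]

lemma signedSum_sub_le {m : ℕ} {d : Fin m → ℝ} {ω : ℝ} (hd : ∀ x, |d x| ≤ ω)
    (h h' : Fin m → Bool) : signedSum d h - signedSum d h' ≤ hammingDist h h' * (2 * ω) := by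
  have : (hammingDist h h' : ℝ) * (2 * ω) = ∑ x, if h x ≠ h' x then 2 * ω else 0 := by
    rw [← Finset.sum_filter, Finset.sum_const, nsmul_eq_mul, hammingDist]
  rw [this, signedSum, signedSum, ← Finset.sum_sub_distrib]
  refine Finset.sum_le_sum fun x _ => ?_
  have := abs_le.1 (hd x)
  cases h x <;> cases h' x <;> simp <;> linarith

/-- Discrete version of the Hobby–Rice theorem. -/
lemma exists_abs_signedSum_le {N m : ℕ} {d : ℕ → Fin m → ℝ} {ω : ℝ} (hω : 0 ≤ ω)
    (hd : ∀ j x, |d j x| ≤ ω) :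
    ∃ h ∈ cutVectors m N, ∀ j < N, |signedSum (d j) h| ≤ N * ω := by
  classical
  let E (j : ℕ) (h : Fin m → Bool) := signedSum (d j) h
  let u (j : ℕ) (s : Bool) (h : Fin m → Bool) : ZMod 2 :=
    if (∀ i < j, |E i h| ≤ N * ω) ∧ N * ω < (if s then E j h else -E j h) then 1 else 0
  have hN : 0 ≤ N * ω := by positivity
  obtain ⟨h, hh, hne⟩ := exists_label_ne_one (m := m) (N := N) (u := u) (by
      intro j s h
      cases s <;> simp [u, E, signedSum_antipode]) (by
      intro j s h h' hhh
      by_contra hne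
      have h1 := left_ne_zero_of_mul hne
      have h2 := right_ne_zero_of_mul hne
      simp only [u, ne_eq, ite_eq_right_iff, one_ne_zero, imp_false, not_not] at h1 h2
      have h3 := signedSum_sub_le (hd j) h h'
      have h4 := signedSum_sub_le (hd j) h' h
      rw [hammingDist_comm] at h4
      have h5 : (hammingDist h h' : ℝ) * (2 * ω) ≤ N * (2 * ω) := by gcongr
      have h6 := h1.2
      have h7 := h2.2
      cases s <;> simp [E] at h6 h7 <;> linarith)
  refine ⟨h, hh, ?_⟩
  have key : ∀ j, labelled u j h = if ∃ i < j, N * ω < |E i h| then 1 else 0 := by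
    intro j
    induction j with
    | zero => simp [labelled]
    | succ j ih =>
      have hsucc : labelled u (j + 1) h = labelled u j h + (u j true h + u j false h) := rfl
      rw [hsucc, ih]
      by_cases h1 : ∃ i < j, N * ω < |E i h|
      · have h2 : ∃ i < j + 1, N * ω < |E i h| := by
          obtain ⟨i, hi, h⟩ := h1
          exact ⟨i, by omega, h⟩
        have h3 : ¬ ∀ i < j, |E i h| ≤ N * ω := by push Not; exact h1
        rw [if_pos h1, if_pos h2]
        simp [u, h3]
      · have h3 : ∀ i < j, |E i h| ≤ N * ω := by push Not at h1; exact h1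
        have h2 : (∃ i < j + 1, N * ω < |E i h|) ↔ N * ω < |E j h| := by
          constructor
          · rintro ⟨i, hi, h4⟩
            rcases Nat.lt_succ_iff_lt_or_eq.1 hi with h5 | rfl
            · exact absurd ⟨i, h5, h4⟩ h1
            · exact h4
          · exact fun h4 => ⟨j, by omega, h4⟩
        rw [if_neg h1, if_congr (h2.trans lt_abs) rfl rfl]
        simp only [u, iff_true_intro h3, true_and]
        by_cases h4 : N * ω < E j h
        · have h5 : ¬ N * ω < - E j h := by linarith
          simp [h4, h5]
        · by_cases h5 : N * ω < - E j h <;> simp [h4, h5]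
  rw [key] at hne
  by_contra! hcon
  exact hne (if_pos hcon)

lemma sum_countP_cons_cons {m a b : ℕ} (hab : a ≤ b) (hb : b ≤ m) {l : List ℕ}
    (hl : ∀ y ∈ l, b ≤ y) (e : ℕ → ℝ) :
    ∑ x ∈ Finset.range m, (if Even ((a :: b :: l).countP (· ≤ x)) then 0 else e (x + 1) - e x)
      = e b - e a
        + ∑ x ∈ Finset.range m, (if Even (l.countP (· ≤ x)) then 0 else e (x + 1) - e x) := by
  have h1 : e b - e a = ∑ x ∈ Finset.range m,
      (if x ∈ Finset.Ico a b then e (x + 1) - e x else 0) := by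
    rw [← Finset.sum_filter, Finset.filter_mem_eq_inter,
      Finset.inter_eq_right.2 (by intro x; simp; omega), Finset.sum_Ico_eq_sub _ hab,
      Finset.sum_range_sub, Finset.sum_range_sub]
    ring
  rw [h1, ← Finset.sum_add_distrib]
  refine Finset.sum_congr rfl fun x _ => ?_
  simp only [List.countP_cons, decide_eq_true_eq, Finset.mem_Ico]
  by_cases hxb : b ≤ x
  · have hxa : a ≤ x := by omega
    have : ¬ x < b := by omega
    simp [hxb, hxa, this, add_assoc, Nat.even_add, show Even 2 from even_two]
  · have h0 : l.countP (· ≤ x) = 0 := by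
      rw [List.countP_eq_zero]
      intro y hy
      have := hl y hy
      simp; omega
    by_cases hxa : a ≤ x <;> simp [hxb, hxa, h0]

lemma exists_intervals {m : ℕ} (r : ℕ) {t : List ℕ} (ht : t.Pairwise (· ≤ ·))
    (htm : ∀ y ∈ t, y ≤ m) (hlen : t.length ≤ 2 * r) :
    ∃ a b : Fin r → ℕ, (∀ i, a i ≤ m) ∧ (∀ i, b i ≤ m) ∧ ∀ e : ℕ → ℝ,
      ∑ x ∈ Finset.range m, (if Even (t.countP (· ≤ x)) then 0 else e (x + 1) - e x)
        = ∑ i, (e (b i) - e (a i)) := by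
  induction r generalizing t with
  | zero =>
    obtain rfl : t = [] := List.eq_nil_of_length_eq_zero (by omega)
    exact ⟨Fin.elim0, Fin.elim0, fun i => i.elim0, fun i => i.elim0, by simp⟩
  | succ r ih =>
    match t, ht, htm, hlen with
    | [], _, _, _ => exact ⟨fun _ => 0, fun _ => 0, by simp, by simp, by simp⟩
    | [y], _, htm, _ =>
      have hy := htm y (by simp)
      refine ⟨fun i => if i = 0 then y else 0, fun i => if i = 0 then m else 0,
        fun i => by dsimp only; split_ifs <;> omega,
        fun i => by dsimp only; split_ifs <;> omega, fun e => ?_⟩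
      have := sum_countP_cons_cons hy le_rfl (l := []) (by simp) e
      simp only [Fin.sum_univ_succ, Fin.succ_ne_zero, if_true, if_false]
      simp only [List.countP_nil, Even.zero, if_true, Finset.sum_const_zero, add_zero] at this
      rw [sub_self, Finset.sum_const_zero, add_zero, ← this]
      refine Finset.sum_congr rfl fun x hx => ?_
      have : ¬ m ≤ x := by simpa using hx
      simp [List.countP_cons, this]
    | a :: b :: l, ht, htm, hlen =>
      simp only [List.pairwise_cons] at ht
      obtain ⟨a', b', ha', hb', h⟩ := ih (t := l) ht.2.2 (fun y hy => htm y (by simp [hy]))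
        (by simp at hlen; omega)
      refine ⟨Fin.cons a a', Fin.cons b b', ?_, ?_, fun e => ?_⟩
      · exact Fin.cases (htm a (by simp)) ha'
      · exact Fin.cases (htm b (by simp)) hb'
      · rw [sum_countP_cons_cons (ht.1 b (by simp)) (htm b (by simp)) ht.2.1, h,
          Fin.sum_univ_succ]
        simp

/-- A form of the Hobby–Rice theorem for `2r` continuous functions. -/
lemma exists_hobbyRice (r : ℕ) (f : Fin (2 * r) → C(ℝ, ℝ)) :
    ∃ a b : Fin r → ℝ, ∀ j, f j 1 - f j 0 = 2 * ∑ i, (f j (b i) - f j (a i)) := by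
  let K : Set ((Fin r → ℝ) × (Fin r → ℝ)) := Set.Icc 0 1
  let Φ (p : (Fin r → ℝ) × (Fin r → ℝ)) (j : Fin (2 * r)) : ℝ :=
    f j 1 - f j 0 - 2 * ∑ i, (f j (p.2 i) - f j (p.1 i))
  have hΦ : Continuous Φ := by fun_prop
  obtain ⟨p, -, hp⟩ := (isCompact_Icc : IsCompact K).exists_isMinOn
    ⟨0, by simp⟩ (hΦ.norm.continuousOn)
  have hle : ∀ ε > 0, ‖Φ p‖ ≤ ε := by
    intro ε hε
    obtain ⟨ω, hω, hωε⟩ : ∃ ω > 0, (2 * r : ℕ) * ω ≤ ε := by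
      refine ⟨ε / ((2 * r : ℕ) + 1), by positivity, ?_⟩
      rw [mul_div_assoc', div_le_iff₀ (by positivity)]
      nlinarith
    have hunif : ∀ j, ∃ δ > 0, ∀ x ∈ Set.Icc (0 : ℝ) 1, ∀ y ∈ Set.Icc (0 : ℝ) 1,
        dist x y < δ → dist (f j x) (f j y) < ω := fun j =>
      Metric.uniformContinuousOn_iff.1
        (isCompact_Icc.uniformContinuousOn_of_continuous (f j).continuous.continuousOn) ω hω
    choose δ hδ hfδ using hunif
    obtain ⟨m, hm⟩ : ∃ m : ℕ, ∀ j, 1 / ((m : ℝ) + 1) < δ j := by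
      have := fun j => (tendsto_one_div_add_atTop_nhds_zero_nat (𝕜 := ℝ)).eventually_lt_const (hδ j)
      exact (Filter.eventually_all.2 this).exists
    let M := m + 1
    have hM : (0 : ℝ) < M := by positivity
    let e (j : ℕ) (x : ℕ) : ℝ := if hj : j < 2 * r then f ⟨j, hj⟩ (x / M) else 0
    have he : ∀ j, ∀ x : Fin M, |e j (x + 1) - e j x| ≤ ω := by
      intro j x
      by_cases hj : j < 2 * r
      · simp only [e, hj, dif_pos]
        have hx : (x : ℝ) + 1 ≤ M := by exact_mod_cast x.2
        refine (hfδ ⟨j, hj⟩ _ ⟨by positivity, ?_⟩ _ ⟨by positivity, ?_⟩ ?_).le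
        · rw [div_le_one hM]; push_cast; exact hx
        · rw [div_le_one hM]; linarith
        · rw [Real.dist_eq, ← sub_div]
          push_cast
          rw [add_sub_cancel_left, abs_of_pos (by positivity)]
          simpa [M] using hm ⟨j, hj⟩
      · simp [e, hj, hω.le]
    obtain ⟨h, ⟨t, ht1, ht2, ht3, ht4⟩, hsmall⟩ := exists_abs_signedSum_le
      (N := 2 * r) (m := M) (d := fun j x => e j (x + 1) - e j x) hω.le he
    obtain ⟨a, b, ha, hb, hab⟩ := exists_intervals r ht1 ht2 ht3
    let q : (Fin r → ℝ) × (Fin r → ℝ) := (fun i => a i / M, fun i => b i / M)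
    have hq : q ∈ K := by
      refine ⟨⟨fun i => ?_, fun i => ?_⟩, ⟨fun i => ?_, fun i => ?_⟩⟩
      · simp only [q, Prod.fst_zero, Pi.zero_apply]; positivity
      · simp only [q, Prod.snd_zero, Pi.zero_apply]; positivity
      · simp only [q, Prod.fst_one, Pi.one_apply]
        rw [div_le_one hM]; exact_mod_cast ha i
      · simp only [q, Prod.snd_one, Pi.one_apply]
        rw [div_le_one hM]; exact_mod_cast hb i
    refine (hp hq).trans ((pi_norm_le_iff_of_nonneg hε.le).2 fun j => ?_)
    refine le_trans (le_of_eq ?_) ((hsmall j j.2).trans hωε)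
    rw [Real.norm_eq_abs]
    congr 1
    have h1 : signedSum (fun x : Fin M => e j (x + 1) - e j x) h
        = ∑ x ∈ Finset.range M, (e j (x + 1) - e j x) - 2 * ∑ x ∈ Finset.range M,
          (if Even (t.countP (· ≤ x)) then 0 else e j (x + 1) - e j x) := by
      rw [Finset.mul_sum, ← Finset.sum_sub_distrib, Finset.sum_range, signedSum]
      refine Finset.sum_congr rfl fun x _ => ?_
      rw [ht4]
      by_cases h5 : Even (t.countP (· ≤ x.val))
      · simp [h5]
      · simp only [h5, decide_false, Bool.false_eq_true, if_false]; ring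
    rw [h1, Finset.sum_range_sub, hab]
    simp [Φ, q, e, hM.ne']
  have h0 : Φ p = 0 := norm_le_zero_iff.1 (le_of_forall_pos_le_add fun ε hε => by
    simpa using hle ε hε)
  exact ⟨p.1, p.2, fun j => sub_eq_zero.1 (congrFun h0 j)⟩

end HobbyRice

section Chords

lemma evalDiff_apply (a b : ℝ) (f : C(ℝ, ℝ)) : evalDiff a b f = f b - f a := rfl

lemma exists_polynomial_eval_eq (s : Finset ℝ) (v : ℝ → ℝ) :
    ∃ p : Polynomial ℝ, p.degree < s.card ∧ ∀ x ∈ s, p.eval x = v x :=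
  ⟨Lagrange.interpolate s id v, Lagrange.degree_interpolate_lt _ (Set.injOn_id _),
    fun _ hx => Lagrange.eval_interpolate_at_node (v := id) _ (Set.injOn_id _) hx⟩

/-- A linearly independent family of chords extends to one of any larger size. -/
lemma exists_linearIndependent_extension {k n : ℕ} (hkn : k ≤ n) (a b : Fin k → ℝ)
    (hab : ∀ i, a i < b i) (hL : LinearIndependent ℝ fun i => evalDiff (a i) (b i)) :
    ∃ a' b' : Fin n → ℝ, (∀ i, a' i < b' i) ∧
      LinearIndependent ℝ (fun i => evalDiff (a' i) (b' i)) ∧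
      Set.range (fun i => evalDiff (a i) (b i)) ⊆ Set.range fun i => evalDiff (a' i) (b' i) := by
  induction n, hkn using Nat.le_induction with
  | base => exact ⟨a, b, hab, hL, subset_rfl⟩
  | succ n _ ih =>
    obtain ⟨a, b, hab, hL, hsub⟩ := ih
    classical
    let T : Finset ℝ := Finset.univ.image a ∪ Finset.univ.image b
    obtain ⟨M, hM⟩ := T.finite_toSet.bddAbove
    obtain ⟨p, -, hp⟩ := exists_polynomial_eval_eq (T ∪ {M + 1, M + 2})
      fun x => if x = M + 2 then 1 else 0
    have hT : ∀ x ∈ T, p.toContinuousMap x = 0 := by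
      intro x hx
      have h1 : x ≤ M := hM hx
      have h2 : x ≠ M + 2 := by linarith
      simpa [h2] using hp x (by simp [hx])
    have hnot : evalDiff (M + 1) (M + 2) ∉
        Submodule.span ℝ (Set.range fun i => evalDiff (a i) (b i)) := by
      intro hmem
      have hle : Submodule.span ℝ (Set.range fun i => evalDiff (a i) (b i))
          ≤ LinearMap.ker (LinearMap.applyₗ (R := ℝ) (M₂ := ℝ) p.toContinuousMap) := by
        rw [Submodule.span_le]
        rintro _ ⟨i, rfl⟩
        simp [evalDiff_apply, hT (a i) (by simp [T]), hT (b i) (by simp [T]),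
          -Polynomial.toContinuousMap_apply]
      have := hle hmem
      have h1 := hp (M + 1) (by simp)
      have h2 := hp (M + 2) (by simp)
      simp [evalDiff_apply, h1, h2] at this
    have heq : (fun i => evalDiff ((Fin.snoc a (M + 1) : Fin (n + 1) → ℝ) i)
          ((Fin.snoc b (M + 2) : Fin (n + 1) → ℝ) i))
        = Fin.snoc (fun i => evalDiff (a i) (b i)) (evalDiff (M + 1) (M + 2)) := by
      funext i
      refine Fin.lastCases ?_ (fun i => ?_) i <;> simp
    refine ⟨Fin.snoc a (M + 1), Fin.snoc b (M + 2), fun i => ?_, ?_, ?_⟩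
    · refine Fin.lastCases ?_ (fun i => ?_) i
      · simp
      · simpa using hab i
    · rw [heq]
      exact hL.finSnoc hnot
    · rw [heq]
      refine hsub.trans ?_
      rintro _ ⟨i, rfl⟩
      exact ⟨i.castSucc, by simp⟩

/-- A functional in the span of `n` chords, possibly degenerate or dependent, is in the span of a
non-resonant `n`-chord diagram. -/
lemma exists_linearIndependent_of_mem_span {n : ℕ} (a b : Fin n → ℝ) {ℓ : C(ℝ, ℝ) →ₗ[ℝ] ℝ}
    (hℓ : ℓ ∈ Submodule.span ℝ (Set.range fun i => evalDiff (a i) (b i))) :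
    ∃ a' b' : Fin n → ℝ, (∀ i, a' i < b' i) ∧
      LinearIndependent ℝ (fun i => evalDiff (a' i) (b' i)) ∧
      ℓ ∈ Submodule.span ℝ (Set.range fun i => evalDiff (a' i) (b' i)) := by
  let c i := min (a i) (b i)
  let d i := max (a i) (b i)
  have hcd : Submodule.span ℝ (Set.range fun i => evalDiff (a i) (b i))
      ≤ Submodule.span ℝ (Set.range fun i => evalDiff (c i) (d i)) := by
    rw [Submodule.span_le]
    rintro _ ⟨i, rfl⟩
    have h1 : evalDiff (c i) (d i) ∈
      Submodule.span ℝ (Set.range fun i => evalDiff (c i) (d i)) :=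
        Submodule.subset_span ⟨i, rfl⟩
    rcases le_total (a i) (b i) with h | h
    · simpa [c, d, h] using h1
    · have h2 : evalDiff (a i) (b i) = -evalDiff (c i) (d i) := by
        ext f; simp [c, d, h, evalDiff_apply]
      simp only [h2]
      exact Submodule.neg_mem _ h1
  obtain ⟨κ, g, hg, hspan, hLI⟩ :=
    exists_linearIndependent' ℝ (fun i => evalDiff (c i) (d i))
  have := Finite.of_injective g hg
  have hcard : Nat.card κ ≤ n := by
    simpa using Nat.card_le_card_of_injective g hg
  let e := Finite.equivFin κ
  have hLI' := hLI.comp e.symm e.symm.injective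
  obtain ⟨a', b', hab, hL, hsub⟩ := exists_linearIndependent_extension hcard
    (fun i => c (g (e.symm i))) (fun i => d (g (e.symm i))) (fun i => by
      refine lt_of_le_of_ne (min_le_max) fun h => hLI'.ne_zero i ?_
      ext f
      simp only [Function.comp_apply, evalDiff_apply, LinearMap.zero_apply]
      rw [h, sub_self]) hLI'
  refine ⟨a', b', hab, hL, ?_⟩
  have h3 := hcd hℓ
  rw [← hspan] at h3
  refine Submodule.span_mono (Set.Subset.trans ?_ hsub) h3
  rintro _ ⟨x, rfl⟩
  exact ⟨e x, by simp⟩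

lemma finrank_inf_iInf_ker_add {V ι : Type*} [AddCommGroup V] [Module ℝ V]
    (F : Submodule ℝ V) [FiniteDimensional ℝ F] (L : ι → V →ₗ[ℝ] ℝ) :
    Module.finrank ℝ ↥(F ⊓ ⨅ i, LinearMap.ker (L i))
      + Module.finrank ℝ (LinearMap.range ((LinearMap.pi L).comp F.subtype))
      = Module.finrank ℝ F := by
  rw [← LinearMap.finrank_range_add_finrank_ker ((LinearMap.pi L).comp F.subtype), add_comm]
  congr 1
  rw [← Submodule.finrank_map_subtype_eq, LinearMap.ker_comp, Submodule.map_comap_subtype,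
    LinearMap.ker_pi]

lemma finrank_le_of_mem_span {V : Type*} [AddCommGroup V] [Module ℝ V] {n : ℕ}
    (F : Submodule ℝ V) [FiniteDimensional ℝ F] (L : Fin n → V →ₗ[ℝ] ℝ) {ℓ : V →ₗ[ℝ] ℝ}
    (hℓ : ℓ ∈ Submodule.span ℝ (Set.range L)) (h0 : ℓ ≠ 0) (hF : ∀ f ∈ F, ℓ f = 0) :
    Module.finrank ℝ F < Module.finrank ℝ ↥(F ⊓ ⨅ i, LinearMap.ker (L i)) + n := by
  rw [← finrank_inf_iInf_ker_add F L]
  have : LinearMap.range ((LinearMap.pi L).comp F.subtype) ≠ ⊤ := by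
    obtain ⟨c, rfl⟩ := (Submodule.mem_span_range_iff_exists_fun ℝ).1 hℓ
    intro htop
    apply h0
    have hc : c = 0 := by
      funext i
      obtain ⟨f, hf⟩ := LinearMap.range_eq_top.1 htop (Pi.single i 1)
      have h1 := hF f f.2
      have h2 : ∀ j, L j f = (Pi.single i 1 : Fin n → ℝ) j := fun j => congrFun hf j
      simpa [LinearMap.sum_apply, h2, Pi.single_apply] using h1
    simp [hc]
  have := Submodule.finrank_lt this
  simp only [Module.finrank_fintype_fun_eq_card, Fintype.card_fin] at this
  omega

/-- In a space of dimension at most `2r`, some non-resonant `(r+1)`-chord diagram imposes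
dependent conditions. -/
lemma exists_chords_finrank_lt (r : ℕ) (F : Submodule ℝ C(ℝ, ℝ)) [FiniteDimensional ℝ F]
    (hF : Module.finrank ℝ F ≤ 2 * r) :
    ∃ a b : Fin (r + 1) → ℝ, (∀ i, a i < b i) ∧
      LinearIndependent ℝ (fun i => evalDiff (a i) (b i)) ∧
      Module.finrank ℝ F
        < Module.finrank ℝ ↥(F ⊓ ⨅ i, LinearMap.ker (evalDiff (a i) (b i))) + (r + 1) := by
  classical
  let B := Module.finBasis ℝ F
  obtain ⟨a, b, hab⟩ := exists_hobbyRice r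
    (fun j => if h : j.val < Module.finrank ℝ F then (B ⟨j, h⟩ : C(ℝ, ℝ)) else 0)
  let ℓ : C(ℝ, ℝ) →ₗ[ℝ] ℝ := evalDiff 0 1 - (2 : ℝ) • ∑ i, evalDiff (a i) (b i)
  have happ : ∀ f : C(ℝ, ℝ), ℓ f = f 1 - f 0 - 2 * ∑ i, (f (b i) - f (a i)) := by
    intro f; simp [ℓ, evalDiff_apply]
  have hℓF : ∀ f ∈ F, ℓ f = 0 := by
    have : ℓ.comp F.subtype = 0 := B.ext fun i => by
      have h := hab ⟨i, i.2.trans_le hF⟩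
      simp only [i.2, dif_pos] at h
      simp only [LinearMap.comp_apply, Submodule.subtype_apply, happ, LinearMap.zero_apply]
      exact sub_eq_zero.2 h
    exact fun f hf => LinearMap.congr_fun this ⟨f, hf⟩
  have h0 : ℓ ≠ 0 := by
    intro hzero
    obtain ⟨p, -, hp⟩ := exists_polynomial_eval_eq
      ({0, 1} ∪ (Finset.univ.image a ∪ Finset.univ.image b)) fun x => if x = 1 then 1 else 0
    have h := happ p.toContinuousMap
    rw [hzero] at h
    simp only [Polynomial.toContinuousMap_apply, LinearMap.zero_apply] at h
    have ha : ∀ i, p.eval (a i) = if a i = 1 then 1 else 0 := fun i => hp _ (by simp)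
    have hb : ∀ i, p.eval (b i) = if b i = 1 then 1 else 0 := fun i => hp _ (by simp)
    rw [hp 1 (by simp), hp 0 (by simp)] at h
    simp only [ha, hb] at h
    have hZ : (0 : ℤ) = 1 - 2 * ∑ i, ((if b i = 1 then 1 else 0) - if a i = 1 then 1 else 0) := by
      have : ((0 : ℤ) : ℝ) = ((1 - 2 * ∑ i, ((if b i = 1 then 1 else 0)
          - if a i = 1 then 1 else 0) : ℤ) : ℝ) := by
        push_cast
        simpa using h
      exact_mod_cast this
    omega
  obtain ⟨a', b', h1, h2, h3⟩ := exists_linearIndependent_of_mem_span (ℓ := ℓ)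
    (Fin.cons 0 a) (Fin.cons 1 b) (by
      refine Submodule.sub_mem _ (Submodule.subset_span ⟨0, by simp⟩)
        (Submodule.smul_mem _ _ (Submodule.sum_mem _ fun i _ => ?_))
      exact Submodule.subset_span ⟨i.succ, by simp⟩)
  exact ⟨a', b', h1, h2, finrank_le_of_mem_span F _ h3 h0 hℓF⟩

lemma finrank_degreeLE (N : ℕ) : FiniteDimensional ℝ (Polynomial.degreeLE ℝ (N : ℕ)) ∧
    Module.finrank ℝ (Polynomial.degreeLE ℝ (N : ℕ)) = N + 1 := by
  have h : Polynomial.degreeLE ℝ (N : ℕ) = Polynomial.degreeLT ℝ (N + 1) := by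
    ext p
    rw [Polynomial.mem_degreeLE, Polynomial.mem_degreeLT, Polynomial.degree_le_iff_coeff_zero,
      Polynomial.degree_lt_iff_coeff_zero]
    exact ⟨fun h m hm => h m (by exact_mod_cast hm), fun h m hm => h m (by exact_mod_cast hm)⟩
  rw [h]
  let e := Polynomial.degreeLTEquiv ℝ (N + 1)
  exact ⟨e.symm.finiteDimensional, by simpa using e.finrank_eq⟩

lemma finrank_Pspace (N : ℕ) :
    FiniteDimensional ℝ (Pspace N) ∧ Module.finrank ℝ (Pspace N) = N := by
  obtain ⟨h1, h2⟩ := finrank_degreeLE N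
  refine ⟨Submodule.finiteDimensional_of_le inf_le_left, ?_⟩
  have h := finrank_inf_iInf_ker_add (Polynomial.degreeLE ℝ (N : ℕ))
    fun _ : Unit => Polynomial.lcoeff ℝ 0
  rw [iInf_const, h2, LinearMap.range_eq_top.2, finrank_top] at h
  · rw [Module.finrank_fintype_fun_eq_card, Fintype.card_unit] at h
    exact Nat.succ.inj h
  · intro v
    refine ⟨⟨Polynomial.C (v ()), ?_⟩, ?_⟩
    · exact Polynomial.mem_degreeLE.2 (Polynomial.degree_C_le.trans (by simp))
    · funext i
      simp

lemma pi_surjective_of_linearIndependent {V : Type*} [AddCommGroup V] [Module ℝ V] {n : ℕ}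
    {L : Fin n → V →ₗ[ℝ] ℝ} (hL : LinearIndependent ℝ L) :
    Function.Surjective (LinearMap.pi L) := by
  rw [← LinearMap.range_eq_top]
  by_contra hne
  obtain ⟨φ, hφ, hle⟩ := Submodule.exists_le_ker_of_lt_top _ (lt_top_iff_ne_top.2 hne)
  apply hφ
  have hsum : ∑ i, φ (Pi.single i 1) • L i = 0 := by
    ext f
    have h1 : φ (LinearMap.pi L f) = 0 := hle ⟨f, rfl⟩
    rw [LinearMap.pi_apply_eq_sum_univ] at h1
    have h2 : ∀ i : Fin n, (fun j => if i = j then (1 : ℝ) else 0) = Pi.single i 1 := by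
      intro i
      funext j
      simp [Pi.single_apply, eq_comm]
    simpa [h2, LinearMap.sum_apply, mul_comm] using h1
  have h0 := Fintype.linearIndependent_iff.1 hL _ hsum
  ext i
  simpa using h0 i

/-- Every non-resonant `n`-chord diagram has codimension `n` in `P^N` for `N ≥ 2n - 1`. -/
lemma finrank_Pspace_inf_chords {n N : ℕ} (hN : 2 * n ≤ N + 1) {a b : Fin n → ℝ}
    (hL : LinearIndependent ℝ fun i => evalDiff (a i) (b i)) :
    Module.finrank ℝ ↥(Pspace N ⊓
      ⨅ i, LinearMap.ker (Polynomial.leval (b i) - Polynomial.leval (a i))) = N - n := by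
  classical
  obtain ⟨h1, h2⟩ := finrank_Pspace N
  have h := finrank_inf_iInf_ker_add (Pspace N)
    fun i => Polynomial.leval (b i) - Polynomial.leval (a i)
  rw [LinearMap.range_eq_top.2, finrank_top, h2] at h
  · simp only [Module.finrank_fintype_fun_eq_card, Fintype.card_fin] at h
    omega
  · intro v
    obtain ⟨f, hf⟩ := pi_surjective_of_linearIndependent hL v
    obtain ⟨p, hdeg, hp⟩ := exists_polynomial_eval_eq
      (Finset.univ.image a ∪ Finset.univ.image b) f
    have hcard : (Finset.univ.image a ∪ Finset.univ.image b).card ≤ N + 1 := by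
      refine (Finset.card_union_le _ _).trans ?_
      have h3 := Finset.card_image_le (s := Finset.univ) (f := a)
      have h4 := Finset.card_image_le (s := Finset.univ) (f := b)
      simp only [Finset.card_univ, Fintype.card_fin] at h3 h4
      omega
    have hdeg' : p.degree ≤ (N : ℕ) := by
      rw [← Polynomial.mem_degreeLE, Polynomial.mem_degreeLE, Polynomial.degree_le_iff_coeff_zero]
      intro m hm
      refine Polynomial.coeff_eq_zero_of_degree_lt (hdeg.trans_le ?_)
      have : N < m := by exact_mod_cast hm
      exact_mod_cast (by omega : (Finset.univ.image a ∪ Finset.univ.image b).card ≤ m)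
    refine ⟨⟨p - Polynomial.C (p.coeff 0), ?_, ?_⟩, ?_⟩
    · refine Submodule.sub_mem _ (Polynomial.mem_degreeLE.2 hdeg')
        (Polynomial.mem_degreeLE.2 (Polynomial.degree_C_le.trans (by simp)))
    · simp
    · funext i
      rw [← hf]
      simp [Polynomial.leval, hp (a i), hp (b i), evalDiff_apply]

end Chords

/-- For `n = 2^k` (`k ≥ 1`), the minimal dimension for which every non-resonant
`n`-chord diagram gives codimension exactly `n` is `2n - 1`:
(i) in `P^{2n-1}` every non-resonant `n`-chord diagram cuts out a subspace of
dimension exactly `(2n - 1) - n`;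
(ii) in any space of dimension `N < 2n - 1` some non-resonant `n`-chord diagram
cuts out a subspace of dimension strictly greater than `N - n`. -/
theorem stmt3 (k : ℕ) (hk : 1 ≤ k) (n : ℕ) (hn : n = 2 ^ k) :
    (∀ a b : Fin n → ℝ, (∀ i, a i < b i) →
      Function.Injective (fun i => (a i, b i)) →
      LinearIndependent ℝ (fun i => evalDiff (a i) (b i)) →
      Module.finrank ℝ
        ↥(Pspace (2 * n - 1) ⊓
            ⨅ i, LinearMap.ker (Polynomial.leval (b i) - Polynomial.leval (a i)))
        = (2 * n - 1) - n) ∧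
    (∀ N : ℕ, N < 2 * n - 1 →
      ∀ F : Submodule ℝ C(ℝ, ℝ), FiniteDimensional ℝ F → Module.finrank ℝ F = N →
      ∃ a b : Fin n → ℝ,
        (∀ i, a i < b i) ∧
        Function.Injective (fun i => (a i, b i)) ∧
        LinearIndependent ℝ (fun i => evalDiff (a i) (b i)) ∧
        (N : ℤ) - n <
          Module.finrank ℝ ↥(F ⊓ ⨅ i, LinearMap.ker (evalDiff (a i) (b i)))) := by
  have hn1 : 1 ≤ n := hn ▸ Nat.one_le_two_pow
  refine ⟨fun a b _ _ hL => finrank_Pspace_inf_chords (by omega) hL, fun N hN F hfin hF => ?_⟩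
  obtain ⟨r, rfl⟩ : ∃ r, n = r + 1 := ⟨n - 1, by omega⟩
  obtain ⟨a, b, hab, hL, hlt⟩ := exists_chords_finrank_lt r F (by omega)
  refine ⟨a, b, hab, fun i j hij => hL.injective ?_, hL, by omega⟩
  simp only [Prod.mk.injEq] at hij
  simp only [hij.1, hij.2]
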